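/- arXiv:2602.13001 — 2 statements merged into one kernel-verified Lean document; each statement's English description precedes it below -/
import Mathlib

section
/- Let c, d, s be positive integers with d ≥ 2, 1 ≤ c, s ≤ d and gcd(cs, d) = 1, let p ≥ 5 be a prime with p ≡ s (mod d), set α = c/d, let r be a positive integer with (1/2+α)^{*_r} · (1/2 + α^{*_r}) ≢ 0 (mod p), and let a = ⟨−α⟩_{p^r}. Then ∑_{l=0}^{a−1} (p^{3r}(p^r + 2α + 2l)/(α+l)^3) · (α+l)_{p^r}^3 (1/2)_{p^r} / ((1)_{p^r}^3 (1/2+α+l)_{p^r}) ≡ ((α^{*_r})^3/(1/2+α)^{*_r}) · p^{r+2} · H^{(2)}_{α^{*_r} p − α^{*_{r−1}}} (mod p^{r+3}). -/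
noncomputable section

/-- Pochhammer symbol `(x)_n = x(x+1)⋯(x+n-1)`. -/
def poch (x : ℚ) (n : ℕ) : ℚ := ∏ i ∈ Finset.range n, (x + i)

/-- `n`-th harmonic number of order 2: `H_n^{(2)} = ∑_{k=1}^n 1/k^2`. -/
def H2 (n : ℕ) : ℚ := ∑ k ∈ Finset.Icc 1 n, (1 : ℚ) / (k : ℚ) ^ 2

/-- Least nonnegative residue of a rational `x` (with denominator coprime to `m`)
modulo `m`: the unique integer in `{0, …, m-1}` congruent to `x` mod `m`. -/
def res (m : ℕ) (x : ℚ) : ℕ := ((x.num : ZMod m) * (x.den : ZMod m)⁻¹).val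

/-- Dwork's dash operation: `x* = (x + ⟨-x⟩_p)/p`. -/
def dash (p : ℕ) (x : ℚ) : ℚ := (x + (res p (-x) : ℚ)) / p

/-- `r`-fold iterate of Dwork's dash operation, with `x^{*_0} = x`. -/
def dashIter (p r : ℕ) (x : ℚ) : ℚ := (dash p)^[r] x

/-- For rationals `u, v`, `u ≡ v (mod p^m)` means `u = v` or the `p`-adic
valuation of `u - v` is at least `m`. -/
def ratCongr (p : ℕ) (m : ℤ) (u v : ℚ) : Prop :=
  u = v ∨ m ≤ padicValRat p (u - v)

/-- 1-units. -/
def V1 (p : ℕ) (x : ℚ) : Prop := padicNorm p (x - 1) < 1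

section
variable {p : ℕ} [hp : Fact p.Prime]

lemma V1.norm {x : ℚ} (h : V1 p x) : padicNorm p x = 1 := by
  have : x = (x - 1) + 1 := by ring
  rw [this, padicNorm.add_eq_max_of_ne]
  · rw [padicNorm.one]; exact max_eq_right (le_of_lt h)
  · rw [padicNorm.one]; exact ne_of_lt h

lemma V1.ne {x : ℚ} (h : V1 p x) : x ≠ 0 := by
  rintro rfl; have := h.norm; simp at this

lemma V1.mul {x y : ℚ} (hx : V1 p x) (hy : V1 p y) : V1 p (x * y) := by
  have : x * y - 1 = x * (y - 1) + (x - 1) := by ring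
  unfold V1; rw [this]
  refine lt_of_le_of_lt padicNorm.nonarchimedean (max_lt ?_ hx)
  rw [padicNorm.mul, hx.norm, one_mul]; exact hy

lemma V1.inv {x : ℚ} (hx : V1 p x) : V1 p x⁻¹ := by
  have : x⁻¹ - 1 = - ((x - 1) / x) := by have := hx.ne; field_simp; ring
  unfold V1; rw [this, padicNorm.neg, padicNorm.div, hx.norm, div_one]; exact hx

lemma V1.div {x y : ℚ} (hx : V1 p x) (hy : V1 p y) : V1 p (x / y) := by
  rw [div_eq_mul_inv]; exact hx.mul hy.inv

lemma V1.one : V1 p 1 := by simp [V1]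

lemma V1.pow3 {x : ℚ} (hx : V1 p x) : V1 p (x ^ 3) := by
  have : x ^ 3 = x * x * x := by ring
  rw [this]; exact (hx.mul hx).mul hx

lemma norm_q (r : ℕ) : padicNorm p ((p:ℚ) ^ r) = ((p:ℚ) ^ r)⁻¹ := by
  induction r with
  | zero => simp
  | succ n ih => rw [pow_succ, padicNorm.mul, ih, padicNorm.padicNorm_p_of_prime, mul_inv]

lemma norm_b_lt {r b : ℕ} (h : ¬ p ^ r ∣ b) : ((p:ℚ) ^ r)⁻¹ < padicNorm p b := by
  have := (padicNorm.dvd_iff_norm_le (p := p) (n := r) (z := (b:ℤ))).not.1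
    (by exact_mod_cast h)
  rw [not_le] at this
  simpa using this

lemma norm_b_le {k b : ℕ} (h : ¬ p ^ (k+1) ∣ b) : ((p:ℚ) ^ k)⁻¹ ≤ padicNorm p b := by
  have h1 := norm_b_lt h
  have hb : (b:ℚ) ≠ 0 := by
    rintro hb
    have : b = 0 := by exact_mod_cast hb
    simp [this] at h
  have hp1 : (1:ℚ) < p := by exact_mod_cast hp.out.one_lt
  rw [padicNorm.eq_zpow_of_nonzero hb] at h1 ⊢
  rw [← zpow_natCast, ← zpow_neg] at h1 ⊢
  rw [zpow_lt_zpow_iff_right₀ hp1] at h1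
  rw [zpow_le_zpow_iff_right₀ hp1]
  push_cast at h1
  omega

lemma not_dvd {r b : ℕ} (h0 : 0 < b) (h1 : b < p ^ r) : ¬ p ^ r ∣ b :=
  fun h => absurd (Nat.le_of_dvd h0 h) (by omega)

/-- `(b + q T)/b` is a 1-unit. -/
lemma V1_qb {r b : ℕ} (h0 : 0 < b) (h1 : b < p ^ r) {T : ℚ} (hT : padicNorm p T ≤ 1) :
    V1 p ((b + (p:ℚ) ^ r * T) / b) := by
  have hb : (b:ℚ) ≠ 0 := by exact_mod_cast h0.ne'
  have h := norm_b_lt (not_dvd h0 h1)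
  have : (b + (p:ℚ) ^ r * T) / b - 1 = ((p:ℚ) ^ r * T) / b := by field_simp; ring
  unfold V1
  have hpos : 0 < ((p:ℚ) ^ r)⁻¹ := by
    have : (0:ℚ) < p := by exact_mod_cast hp.out.pos
    positivity
  rw [this, padicNorm.div, padicNorm.mul, norm_q, div_lt_one (hpos.trans h)]
  refine lt_of_le_of_lt ?_ h
  exact mul_le_of_le_one_right hpos.le hT

lemma poch_zero_aux (r : ℕ) (X : ℚ) (hX : padicNorm p X ≤ 1) (m : ℕ) (hm : m < p ^ r) :
    ∃ u, V1 p u ∧ ∏ j ∈ Finset.range m, ((p:ℚ)^r * X + ((j + 1 : ℕ) : ℚ)) = (m.factorial : ℚ) * u := by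
  induction m with
  | zero => exact ⟨1, V1.one, by simp⟩
  | succ m ih =>
    obtain ⟨u, hu, e⟩ := ih (by omega)
    refine ⟨_, hu.mul (V1_qb (p := p) (r := r) (Nat.succ_pos m) hm hX), ?_⟩
    rw [Finset.prod_range_succ, e, Nat.factorial_succ]
    have : ((m + 1 : ℕ) : ℚ) ≠ 0 := by positivity
    push_cast at *
    field_simp
    ring

lemma poch_main (r : ℕ) (X : ℚ) (hX : padicNorm p X ≤ 1) (e : ℕ) (he : e < p ^ r) :
    ∃ u, V1 p u ∧ poch ((p:ℚ)^r * X - e) (p ^ r) = (p:ℚ)^r * X * ((p ^ r - 1).factorial : ℚ) * u := by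
  induction e with
  | zero =>
    obtain ⟨u, hu, e⟩ := poch_zero_aux r X hX (p ^ r - 1) (by omega)
    refine ⟨u, hu, ?_⟩
    rw [mul_assoc, ← e]
    unfold poch
    obtain ⟨m, hm⟩ : ∃ m, p ^ r = m + 1 := ⟨p ^ r - 1, by omega⟩
    rw [hm, Finset.prod_range_succ']
    simp [mul_comm]
  | succ e ih =>
    obtain ⟨u, hu, h⟩ := ih (by omega)
    have v1 := V1_qb (p := p) (r := r) (b := e + 1) (by omega) he (T := -X)
      (by rwa [padicNorm.neg])
    have v2 := V1_qb (p := p) (r := r) (b := e + 1) (by omega) he (T := -(X+1))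
      (by rw [padicNorm.neg]
          exact padicNorm.nonarchimedean.trans (max_le hX (by simp)))
    refine ⟨_, hu.mul (v1.div v2), ?_⟩
    have hb : ((e + 1 : ℕ) : ℚ) ≠ 0 := by positivity
    have n2 := v2.ne
    rw [div_ne_zero_iff] at n2
    have n3 := n2.1
    set A := ((p:ℚ)^r * X - ((e + 1 : ℕ) : ℚ)) with hA
    set B := ((p:ℚ)^r * X - ((e + 1 : ℕ) : ℚ) + (p:ℚ)^r) with hB
    have key : poch A (p ^ r) * B = A * poch ((p:ℚ)^r * X - e) (p ^ r) := by
      have e1 : poch A (p ^ r) * B = poch A (p ^ r + 1) := by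
        unfold poch; rw [Finset.prod_range_succ]; push_cast; simp [hA, hB]
      rw [e1]
      unfold poch
      rw [Finset.prod_range_succ', mul_comm]
      congr 1
      · simp
      · apply Finset.prod_congr rfl; intro i _; rw [hA]; push_cast; ring
    have r1 : (((e + 1 : ℕ) : ℚ) + (p:ℚ)^r * -X) = -A := by rw [hA]; ring
    have r2 : (((e + 1 : ℕ) : ℚ) + (p:ℚ)^r * -(X+1)) = -B := by rw [hB]; ring
    rw [r1, r2]
    rw [r2] at n3
    have nB : B ≠ 0 := by simpa using n3
    rw [h] at key
    have : poch A (p ^ r) = A * ((p:ℚ) ^ r * X * ((p ^ r - 1).factorial : ℚ) * u) / B := by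
      rw [eq_div_iff nB, key]
    rw [this]
    field_simp

lemma res_spec (k : ℕ) (x : ℚ) (hx : padicNorm p x ≤ 1) :
    res (p ^ k) (-x) < p ^ k ∧ padicNorm p (x + res (p ^ k) (-x)) ≤ ((p:ℚ)^k)⁻¹ := by
  haveI : NeZero (p ^ k) := ⟨pow_ne_zero _ hp.out.ne_zero⟩
  have hden : ¬ p ∣ x.den := by
    intro hd
    have h1 : padicNorm p x * padicNorm p x.den = padicNorm p x.num := by
      rw [← padicNorm.mul, Rat.mul_den_eq_num]
    have h2 : padicNorm p x.den < 1 := (padicNorm.nat_lt_one_iff _).2 hd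
    have h3 : padicNorm p x.num < 1 := by
      rw [← h1]
      exact lt_of_le_of_lt (mul_le_of_le_one_left (padicNorm.nonneg _) hx) h2
    have h4 := (padicNorm.int_lt_one_iff _).1 h3
    have h5 : p ∣ x.num.natAbs := by exact Int.natCast_dvd.1 h4
    have := Nat.dvd_gcd h5 hd
    rw [Nat.Coprime.gcd_eq_one x.reduced] at this
    exact hp.out.one_lt.ne' (Nat.dvd_one.1 this)
  have hd1 : padicNorm p x.den = 1 := (padicNorm.nat_eq_one_iff _).2 hden
  refine ⟨ZMod.val_lt _, ?_⟩
  set e := res (p ^ k) (-x) with he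
  have hcop : Nat.Coprime x.den (p ^ k) :=
    Nat.Coprime.pow_right _ ((Nat.Prime.coprime_iff_not_dvd hp.out).2 hden).symm
  have hz : ((x.num + x.den * (e:ℤ) : ℤ) : ZMod (p ^ k)) = 0 := by
    push_cast
    rw [he]
    unfold res
    rw [ZMod.natCast_zmod_val]
    have := ZMod.coe_mul_inv_eq_one x.den hcop
    simp only [Rat.neg_num, Rat.neg_den]
    push_cast
    linear_combination (-(x.num : ZMod (p^k))) * this
  have hdv := (ZMod.intCast_zmod_eq_zero_iff_dvd _ _).1 hz
  have hn := (padicNorm.dvd_iff_norm_le (p := p)).1 hdv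
  have : x + e = ((x.num + x.den * (e:ℤ) : ℤ) : ℚ) / x.den := by
    have : (x.den : ℚ) ≠ 0 := by exact_mod_cast x.den_ne_zero
    rw [eq_div_iff this]
    push_cast
    rw [← Rat.mul_den_eq_num]; ring
  rw [this, padicNorm.div, hd1, div_one]
  simpa using hn

lemma res_unique {k : ℕ} {x : ℚ} {e f : ℕ} (he : e < p ^ k) (hf : f < p ^ k)
    (h1 : padicNorm p (x + e) ≤ ((p:ℚ)^k)⁻¹) (h2 : padicNorm p (x + f) ≤ ((p:ℚ)^k)⁻¹) : e = f := by
  have h3 : padicNorm p (((e:ℤ) - f : ℤ) : ℚ) ≤ (p:ℚ) ^ (-(k:ℤ)) := by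
    have : (((e:ℤ) - f : ℤ) : ℚ) = (x + e) - (x + f) := by push_cast; ring
    rw [this]
    refine padicNorm.sub.trans ?_
    rw [zpow_neg, zpow_natCast]
    exact max_le h1 h2
  have h4 := padicNorm.dvd_iff_norm_le.2 h3
  have h5 := Int.eq_zero_of_abs_lt_dvd h4 (by rw [abs_lt]; constructor <;> omega)
  omega

lemma norm_div_q {k : ℕ} {y : ℚ} (h : padicNorm p y ≤ ((p:ℚ)^k)⁻¹) :
    padicNorm p (y / (p:ℚ)^k) ≤ 1 := by
  have : (0:ℚ) < p := by exact_mod_cast hp.out.pos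
  rw [padicNorm.div, norm_q, div_le_one (by positivity)]
  exact h

lemma norm_mul_q {k : ℕ} {y : ℚ} (h : padicNorm p y ≤ 1) :
    padicNorm p ((p:ℚ)^k * y) ≤ ((p:ℚ)^k)⁻¹ := by
  have : (0:ℚ) < p := by exact_mod_cast hp.out.pos
  rw [padicNorm.mul, norm_q]
  exact mul_le_of_le_one_right (by positivity) h

lemma dash_spec (x : ℚ) (hx : padicNorm p x ≤ 1) (k : ℕ) :
    padicNorm p (dashIter p k x) ≤ 1 ∧
    ∃ e, e < p ^ k ∧ x + e = (p:ℚ)^k * dashIter p k x := by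
  induction k with
  | zero => exact ⟨by simpa [dashIter] using hx, 0, by simp, by simp [dashIter]⟩
  | succ k ih =>
    obtain ⟨h1, e, h2, h3⟩ := ih
    obtain ⟨h4, h5⟩ := res_spec 1 (dashIter p k x) h1
    rw [pow_one] at h4 h5
    have hpp : (p:ℚ) ≠ 0 := by exact_mod_cast hp.out.ne_zero
    have e1 : dashIter p (k+1) x = (dashIter p k x + (res p (-(dashIter p k x)) : ℚ)) / p := by
      unfold dashIter; rw [Function.iterate_succ_apply']; rfl
    refine ⟨?_, e + p ^ k * res p (-(dashIter p k x)), ?_, ?_⟩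
    · rw [e1]
      have := norm_div_q (k := 1) h5
      rwa [pow_one] at this
    · calc _ < p ^ k + p ^ k * res p (-(dashIter p k x)) := by omega
        _ = p ^ k * (res p (-(dashIter p k x)) + 1) := by ring
        _ ≤ p ^ k * p := Nat.mul_le_mul_left _ h4
        _ = _ := by ring
    · rw [e1]; push_cast
      rw [← add_assoc, h3]; field_simp; ring

omit hp in
lemma sum_Icc_one {M : Type*} [AddCommMonoid M] (f : ℕ → M) (n : ℕ) :
    ∑ k ∈ Finset.Icc 1 n, f k = ∑ k ∈ Finset.range n, f (k + 1) := by
  induction n with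
  | zero => simp
  | succ n ih => rw [Finset.sum_Icc_succ_top (by omega), ih, Finset.sum_range_succ]

lemma H2_half (hp5 : 5 ≤ p) {h : ℕ} (hh : p = 2 * h + 1) : padicNorm p (H2 h) < 1 := by
  have hz : ∑ k ∈ Finset.Icc 1 h, ((k : ZMod p)⁻¹) ^ 2 = 0 := by
    have h0 : ∑ x : ZMod p, (x⁻¹) ^ 2 = 0 := by
      rw [Function.Bijective.sum_comp (inv_involutive (G := ZMod p)).bijective (fun x => x ^ 2)]
      apply FiniteField.sum_pow_lt_card_sub_one
      rw [ZMod.card]; omega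
    have h1 : ∑ x : ZMod p, (x⁻¹) ^ 2 = ∑ k ∈ Finset.range p, ((k : ZMod p)⁻¹) ^ 2 := by
      symm
      apply Finset.sum_bij (fun (k : ℕ) _ => (k : ZMod p))
      · simp
      · intro a ha b hb hab
        have := (ZMod.natCast_eq_natCast_iff' _ _ _).1 hab
        rwa [Nat.mod_eq_of_lt (Finset.mem_range.1 ha), Nat.mod_eq_of_lt (Finset.mem_range.1 hb)] at this
      · intro b _
        exact ⟨b.val, Finset.mem_range.2 (ZMod.val_lt b), by simp⟩
      · simp
    have h2 : ∑ k ∈ Finset.range p, ((k : ZMod p)⁻¹) ^ 2 =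
        2 * ∑ k ∈ Finset.range h, (((k + 1 : ℕ) : ZMod p)⁻¹) ^ 2 := by
      have : Finset.range p = Finset.range (1 + h + h) := by congr 1; omega
      rw [this, Finset.sum_range_add, two_mul]
      congr 1
      · rw [add_comm 1 h, Finset.sum_range_succ']; simp
      · rw [← Finset.sum_range_reflect]
        apply Finset.sum_congr rfl
        intro j hj
        have hj := Finset.mem_range.1 hj
        have : ((1 + h + (h - 1 - j) : ℕ) : ZMod p) = - ((j + 1 : ℕ) : ZMod p) := by
          rw [eq_neg_iff_add_eq_zero, ← Nat.cast_add]
          have : 1 + h + (h - 1 - j) + (j + 1) = p := by omega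
          rw [this]; simp
        rw [this, inv_neg, neg_sq]
    have h3 : (2 : ZMod p) ≠ 0 := by
      intro h
      have h' : ((2:ℕ) : ZMod p) = 0 := by exact_mod_cast h
      have := Nat.le_of_dvd (by norm_num) ((ZMod.natCast_eq_zero_iff _ _).1 h')
      omega
    rw [h1, h2] at h0
    have h4 := (mul_eq_zero.1 h0).resolve_left h3
    rw [← h4, sum_Icc_one]
  have hd : padicNorm p ((∑ k ∈ Finset.Icc 1 h, ((k : ZMod p)⁻¹).val ^ 2 : ℕ) : ℚ) < 1 := by
    rw [padicNorm.nat_lt_one_iff, ← ZMod.natCast_eq_zero_iff]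
    push_cast
    simpa using hz
  have hdiff : padicNorm p (∑ k ∈ Finset.Icc 1 h, (1 / (k:ℚ) ^ 2 - (((k : ZMod p)⁻¹).val : ℚ) ^ 2)) < 1 := by
    apply padicNorm.sum_lt' _ one_pos
    intro k hk
    have hk := Finset.mem_Icc.1 hk
    have hkn : ¬ p ∣ k := fun hd => absurd (Nat.le_of_dvd (by omega) hd) (by omega)
    have hk0 : (k:ℚ) ≠ 0 := by have : 0 < k := by omega
                               positivity
    set m := ((k : ZMod p)⁻¹).val with hm
    have : 1 / (k:ℚ)^2 - (m:ℚ)^2 = ((1 - (k:ℤ)^2 * (m:ℤ)^2 : ℤ) : ℚ) / (k:ℚ)^2 := by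
      push_cast; field_simp
    rw [this, padicNorm.div, pow_two (k:ℚ), padicNorm.mul, (padicNorm.nat_eq_one_iff k).2 hkn]
    rw [mul_one, div_one, padicNorm.int_lt_one_iff, ← ZMod.intCast_zmod_eq_zero_iff_dvd]
    push_cast
    rw [hm, ZMod.natCast_zmod_val]
    have : (k : ZMod p) ≠ 0 := by rwa [Ne, ZMod.natCast_eq_zero_iff]
    field_simp
    simp
  have : H2 h = (∑ k ∈ Finset.Icc 1 h, (1 / (k:ℚ) ^ 2 - (((k : ZMod p)⁻¹).val : ℚ) ^ 2))
     + ((∑ k ∈ Finset.Icc 1 h, ((k : ZMod p)⁻¹).val ^ 2 : ℕ) : ℚ) := by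
    push_cast
    rw [← Finset.sum_add_distrib]
    unfold H2
    apply Finset.sum_congr rfl; intros; ring
  rw [this]
  exact lt_of_le_of_lt padicNorm.nonarchimedean (max_lt hdiff hd)

lemma term_main (r : ℕ) (A Bl x : ℚ) (b e : ℕ) (hp2 : p ≠ 2) (hA : padicNorm p A ≤ 1)
    (hB : padicNorm p Bl = 1)
    (h0 : 0 < b) (hb : b < p ^ r) (he : e < p ^ r) (hx : x = (p:ℚ)^r * A - b)
    (hy : 1/2 + x = (p:ℚ)^r * Bl - e) :
    ∃ w, V1 p w ∧ ((p : ℚ) ^ (3 * r) * ((p : ℚ) ^ r + 2 * x) / x ^ 3) *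
          poch x (p ^ r) ^ 3 * poch (1/2) (p ^ r) /
            (poch 1 (p ^ r) ^ 3 * poch (1/2 + x) (p ^ r)) =
      (A ^ 3 / Bl) * (((p:ℚ)^r) ^ 3 / (b:ℚ)^2) * w := by
  have h2 : padicNorm p (1/2 : ℚ) = 1 := by
    have : padicNorm p ((2:ℕ):ℚ) = 1 := by
      rw [padicNorm.nat_eq_one_iff, Nat.prime_dvd_prime_iff_eq hp.out Nat.prime_two]; exact hp2
    rw [padicNorm.div, padicNorm.one]; push_cast at this; rw [this]; norm_num
  have hodd : p ^ r % 2 = 1 := Nat.odd_iff.1 ((hp.out.odd_of_ne_two hp2).pow)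
  obtain ⟨t, ht⟩ : ∃ t, p ^ r = 2 * t + 1 := ⟨p ^ r / 2, by omega⟩
  have htq : (p:ℚ)^r = 2 * t + 1 := by exact_mod_cast ht
  obtain ⟨u1, hu1, E1⟩ := poch_main (p := p) r A hA b hb
  obtain ⟨u2, hu2, E2⟩ := poch_main (p := p) r (1/2) h2.le t (by omega)
  obtain ⟨u3, hu3, E3⟩ := poch_main (p := p) r Bl hB.le e he
  obtain ⟨u4, hu4, E4⟩ := poch_main (p := p) r 1 (by simp) (2 * t) (by omega)
  rw [← hx] at E1
  rw [← hy] at E3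
  rw [show (p:ℚ)^r * (1/2) - t = 1/2 by rw [htq]; ring] at E2
  rw [show (p:ℚ)^r * 1 - ((2 * t : ℕ):ℚ) = 1 by rw [htq]; push_cast; ring] at E4
  have v1 := V1_qb (p := p) (r := r) h0 hb (T := -A) (by rwa [padicNorm.neg])
  have v2 := V1_qb (p := p) (r := r) h0 hb (T := -(A+1/2)) (by
    rw [padicNorm.neg]; exact padicNorm.nonarchimedean.trans (max_le hA h2.le))
  set w1 := ((b:ℚ) + (p:ℚ) ^ r * -A) / b with hw1
  set w2 := ((b:ℚ) + (p:ℚ) ^ r * -(A+1/2)) / b with hw2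
  have hb0 : (b:ℚ) ≠ 0 := by exact_mod_cast h0.ne'
  have X1 : x = -(b * w1) := by rw [hx, hw1]; field_simp; ring
  have X2 : (p:ℚ)^r + 2 * x = -(2 * b * w2) := by rw [hx, hw2]; field_simp; ring
  refine ⟨(w2 / w1 ^ 3) * (u1 ^ 3 * u2 / (u4 ^ 3 * u3)), ?_, ?_⟩
  · exact (v2.div v1.pow3).mul ((hu1.pow3.mul hu2).div (hu4.pow3.mul hu3))
  · rw [E1, E2, E3, E4, X2, X1]
    have n1 := v1.ne
    have n3 := hu3.ne
    have n4 := hu4.ne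
    have nB : Bl ≠ 0 := by rintro rfl; simp at hB
    have nq : (p:ℚ)^r ≠ 0 := pow_ne_zero _ (by exact_mod_cast hp.out.ne_zero)
    have nf : ((p^r-1).factorial : ℚ) ≠ 0 := by positivity
    rw [mul_comm 3 r, pow_mul]
    generalize (p:ℚ)^r = Q at *
    generalize ((p^r-1).factorial : ℚ) = f at *
    clear_value w1 w2
    field_simp

lemma G_le {k b : ℕ} (h0 : 0 < b) (h1 : b < p ^ (k+1)) :
    padicNorm p (((p:ℚ)^(k+1)) ^ 3 / (b:ℚ)^2) ≤ ((p:ℚ)^(k+3))⁻¹ := by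
  have h := norm_b_le (not_dvd h0 h1)
  have hpp : (0:ℚ) < p := by exact_mod_cast hp.out.pos
  have hq : 0 < ((p:ℚ) ^ k)⁻¹ := by positivity
  rw [padicNorm.div, ← pow_mul, norm_q, pow_two (b:ℚ), padicNorm.mul, ← pow_two,
    div_le_iff₀ (pow_pos (hq.trans_le h) 2)]
  calc ((p:ℚ)^((k+1)*3))⁻¹ = ((p:ℚ)^(k+3))⁻¹ * (((p:ℚ) ^ k)⁻¹)^2 := by
        rw [inv_pow, ← mul_inv]; congr 1; ring
    _ ≤ _ := by gcongr

lemma G_lt {k b : ℕ} (h1 : ¬ p ^ k ∣ b) :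
    padicNorm p (((p:ℚ)^(k+1)) ^ 3 / (b:ℚ)^2) < ((p:ℚ)^(k+3))⁻¹ := by
  have h := norm_b_lt h1
  have hpp : (0:ℚ) < p := by exact_mod_cast hp.out.pos
  have hq : 0 < ((p:ℚ) ^ k)⁻¹ := by positivity
  rw [padicNorm.div, ← pow_mul, norm_q, pow_two (b:ℚ), padicNorm.mul, ← pow_two,
    div_lt_iff₀ (pow_pos (hq.trans h) 2)]
  calc ((p:ℚ)^((k+1)*3))⁻¹ = ((p:ℚ)^(k+3))⁻¹ * (((p:ℚ) ^ k)⁻¹)^2 := by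
        rw [inv_pow, ← mul_inv]; congr 1; ring
    _ < _ := by gcongr

lemma norm_AB {A B : ℚ} (hA : padicNorm p A ≤ 1) (hB : padicNorm p B = 1) :
    padicNorm p (A ^ 3 / B) ≤ 1 := by
  rw [padicNorm.div, hB, div_one, pow_succ, pow_two, padicNorm.mul, padicNorm.mul]
  have := padicNorm.nonneg (p := p) A
  exact mul_le_one₀ (mul_le_one₀ hA this hA) this hA

lemma sum_dvd_filter (m a n : ℕ) (hm : 0 < m) (hn : n = a / m) (f : ℕ → ℚ) :
    ∑ b ∈ Finset.Icc 1 a with m ∣ b, f b = ∑ j ∈ Finset.Icc 1 n, f (m * j) := by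
  symm
  apply Finset.sum_bij (fun j _ => m * j)
  · intro j hj
    have hj := Finset.mem_Icc.1 hj
    rw [hn, Nat.le_div_iff_mul_le hm] at hj
    simp only [Finset.mem_filter, Finset.mem_Icc]
    refine ⟨⟨Nat.mul_pos hm (by omega), by linarith⟩, dvd_mul_right _ _⟩
  · intro i _ j _ h
    exact Nat.eq_of_mul_eq_mul_left hm h
  · intro b hb
    simp only [Finset.mem_filter, Finset.mem_Icc] at hb
    obtain ⟨⟨h1, h2⟩, j, rfl⟩ := hb
    refine ⟨j, Finset.mem_Icc.2 ⟨?_, ?_⟩, rfl⟩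
    · rcases Nat.eq_zero_or_pos j with h | h
      · simp [h] at h1
      · exact h
    · rw [hn, Nat.le_div_iff_mul_le hm]; linarith
  · intros; rfl

/-- assembling the sum -/
lemma assemble (k a n h : ℕ) (A B : ℚ) (Bf F : ℕ → ℚ) (hp5 : 5 ≤ p) (hh : p = 2 * h + 1)
    (hA : padicNorm p A ≤ 1) (hB : padicNorm p B = 1) (ha : a < p ^ (k+1)) (hn : n = a / p ^ k)
    (hAh : padicNorm p (A + 1/2) = 1)
    (hBf : ∀ b, 0 < b → b ≤ a → Bf b = if 2 * b < p ^ (k+1) then A + 1/2 else B)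
    (hcase : B = A + 1/2 ∨ p ^ (k+1) < 2 * a)
    (hF : ∀ b, 0 < b → b ≤ a → ∃ w, V1 p w ∧
      F b = (A ^ 3 / Bf b) * (((p:ℚ)^(k+1)) ^ 3 / (b:ℚ)^2) * w) :
    padicNorm p (∑ b ∈ Finset.Icc 1 a, F b - A ^ 3 / B * (p:ℚ)^(k+3) * H2 n) <
      ((p:ℚ)^(k+3))⁻¹ := by
  have hpp : (0:ℚ) < p := by exact_mod_cast hp.out.pos
  have hpos : (0:ℚ) < ((p:ℚ)^(k+3))⁻¹ := by positivity
  have hBn : ∀ b, 0 < b → b ≤ a → padicNorm p (Bf b) = 1 := by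
    intro b h0 h1
    rw [hBf b h0 h1]; split_ifs <;> assumption
  set G : ℕ → ℚ := fun b => (A ^ 3 / Bf b) * (((p:ℚ)^(k+1)) ^ 3 / (b:ℚ)^2) with hG
  have d1 : padicNorm p (∑ b ∈ Finset.Icc 1 a, (F b - G b)) < ((p:ℚ)^(k+3))⁻¹ := by
    apply padicNorm.sum_lt' _ hpos
    intro b hb
    obtain ⟨h0, h1⟩ := Finset.mem_Icc.1 hb
    obtain ⟨w, hw, e⟩ := hF b h0 h1
    have : F b - G b = (A ^ 3 / Bf b) * (((p:ℚ)^(k+1)) ^ 3 / (b:ℚ)^2) * (w - 1) := by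
      rw [e, hG]; ring
    rw [this, padicNorm.mul, padicNorm.mul]
    have i1 := norm_AB hA (hBn b h0 h1)
    have i2 := G_le (p := p) (k := k) h0 (by omega : b < _)
    have i3 : padicNorm p (w - 1) < 1 := hw
    have j1 := padicNorm.nonneg (p := p) (w - 1)
    have j2 := padicNorm.nonneg (p := p) (((p:ℚ)^(k+1)) ^ 3 / (b:ℚ)^2)
    calc _ ≤ 1 * ((p:ℚ)^(k+3))⁻¹ * padicNorm p (w - 1) := by gcongr
      _ < 1 * ((p:ℚ)^(k+3))⁻¹ * 1 := by gcongr
      _ = _ := by ring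
  have d2 : padicNorm p (∑ b ∈ Finset.Icc 1 a with ¬ p ^ k ∣ b, G b) < ((p:ℚ)^(k+3))⁻¹ := by
    apply padicNorm.sum_lt' _ hpos
    intro b hb
    obtain ⟨hb, hd⟩ := Finset.mem_filter.1 hb
    obtain ⟨h0, h1⟩ := Finset.mem_Icc.1 hb
    rw [hG, padicNorm.mul]
    exact lt_of_le_of_lt (mul_le_of_le_one_left (padicNorm.nonneg _) (norm_AB hA (hBn b h0 h1)))
      (G_lt hd)
  have hpk : 0 < p ^ k := pow_pos hp.out.pos _
  have s3 : ∑ b ∈ Finset.Icc 1 a with p ^ k ∣ b, G b = ∑ j ∈ Finset.Icc 1 n, G (p ^ k * j) :=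
    sum_dvd_filter _ _ _ hpk hn G
  have d3 : padicNorm p (∑ j ∈ Finset.Icc 1 n, (G (p ^ k * j) - A ^ 3 / B * (p:ℚ)^(k+3) * (1 / (j:ℚ)^2)))
      < ((p:ℚ)^(k+3))⁻¹ := by
    have nB : B ≠ 0 := by rintro rfl; simp at hB
    have nA : A + 1/2 ≠ 0 := by intro hz; rw [hz] at hAh; simp at hAh
    have e1 : ∀ j ∈ Finset.Icc 1 n, G (p ^ k * j) - A ^ 3 / B * (p:ℚ)^(k+3) * (1 / (j:ℚ)^2)
        = if 2 * j < p then (A^3 / (A + 1/2) - A^3 / B) * (p:ℚ)^(k+3) * (1 / (j:ℚ)^2) else 0 := by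
      intro j hj
      obtain ⟨h0, h1⟩ := Finset.mem_Icc.1 hj
      rw [hn, Nat.le_div_iff_mul_le hpk] at h1
      have hiff : 2 * (p ^ k * j) < p ^ (k+1) ↔ 2 * j < p := by
        rw [pow_succ, show 2 * (p ^ k * j) = p ^ k * (2 * j) by ring, Nat.mul_lt_mul_left hpk]
      have hj0 : (j:ℚ) ≠ 0 := by positivity
      have hq : ((p:ℚ)^(k+1)) ^ 3 / ((p ^ k * j : ℕ):ℚ)^2 = (p:ℚ)^(k+3) * (1 / (j:ℚ)^2) := by
        push_cast; field_simp; ring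
      simp only [hG]
      rw [hq, hBf _ (Nat.mul_pos hpk h0) (by linarith)]
      simp only [hiff]
      split_ifs
      · ring
      · ring
    rw [Finset.sum_congr rfl e1]
    rcases hcase with hc | hc
    · rw [hc]; simpa using hpos
    · have hhn : h ≤ n := by
        rw [hn, Nat.le_div_iff_mul_le hpk]
        have : 2 * (h * p ^ k) + p ^ k = p ^ (k+1) := by
          have e : p ^ (k+1) = p ^ k * (2 * h + 1) := by rw [← hh, pow_succ]
          rw [e]; ring
        omega
      have hfil : (Finset.Icc 1 n).filter (fun j => 2 * j < p) = Finset.Icc 1 h := by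
        ext j; simp only [Finset.mem_filter, Finset.mem_Icc]; omega
      rw [← Finset.sum_filter, hfil, ← Finset.mul_sum]
      have hH := H2_half hp5 hh
      unfold H2 at hH
      rw [padicNorm.mul, padicNorm.mul, norm_q]
      have i1 : padicNorm p (A^3 / (A + 1/2) - A^3 / B) ≤ 1 :=
        padicNorm.sub.trans (max_le (norm_AB hA hAh) (norm_AB hA hB))
      have j1 := padicNorm.nonneg (p := p) (∑ k ∈ Finset.Icc 1 h, 1 / (k:ℚ) ^ 2)
      calc _ ≤ 1 * ((p:ℚ)^(k+3))⁻¹ * padicNorm p (∑ k ∈ Finset.Icc 1 h, 1 / (k:ℚ) ^ 2) := by gcongr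
        _ < 1 * ((p:ℚ)^(k+3))⁻¹ * 1 := by gcongr
        _ = _ := by ring
  have : ∑ b ∈ Finset.Icc 1 a, F b - A ^ 3 / B * (p:ℚ)^(k+3) * H2 n =
      ∑ b ∈ Finset.Icc 1 a, (F b - G b) + (∑ b ∈ Finset.Icc 1 a with ¬ p ^ k ∣ b, G b +
      ∑ j ∈ Finset.Icc 1 n, (G (p ^ k * j) - A ^ 3 / B * (p:ℚ)^(k+3) * (1 / (j:ℚ)^2))) := by
    rw [Finset.sum_sub_distrib, Finset.sum_sub_distrib, ← Finset.mul_sum, ← s3,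
      ← Finset.sum_filter_add_sum_filter_not (Finset.Icc 1 a) (fun b => p ^ k ∣ b) G]
    unfold H2
    ring
  rw [this]
  exact lt_of_le_of_lt padicNorm.nonarchimedean (max_lt d1
    (lt_of_le_of_lt padicNorm.nonarchimedean (max_lt d2 d3)))

lemma ratCongr_of {m : ℕ} {u v : ℚ} (h : padicNorm p (u - v) < ((p:ℚ)^m)⁻¹) :
    ratCongr p ((m:ℤ) + 1) u v := by
  by_cases huv : u = v
  · exact Or.inl huv
  · right
    have h0 : u - v ≠ 0 := sub_ne_zero.2 huv
    have hp1 : (1:ℚ) < p := by exact_mod_cast hp.out.one_lt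
    rw [padicNorm.eq_zpow_of_nonzero h0, ← zpow_natCast, ← zpow_neg,
      zpow_lt_zpow_iff_right₀ hp1] at h
    omega

lemma of_not_ratCongr {x : ℚ} (h : ¬ ratCongr p 1 x 0) : 1 ≤ padicNorm p x := by
  unfold ratCongr at h
  rw [not_or, sub_zero, not_le] at h
  have hp1 : (1:ℚ) < p := by exact_mod_cast hp.out.one_lt
  rw [padicNorm.eq_zpow_of_nonzero h.1]
  exact one_le_zpow₀ hp1.le (by omega)

end

theorem stmt14 (c d s : ℕ) (hc1 : 1 ≤ c) (hcd : c ≤ d) (hs1 : 1 ≤ s) (hsd : s ≤ d)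
    (hd : 2 ≤ d) (hgcd : Nat.gcd (c * s) d = 1)
    (p : ℕ) (hp : p.Prime) (hp5 : 5 ≤ p) (hps : p ≡ s [MOD d])
    (α : ℚ) (hα : α = (c : ℚ) / d)
    (r : ℕ) (hr : 1 ≤ r)
    (hnd : ¬ ratCongr p 1 (dashIter p r (1/2 + α) * (1/2 + dashIter p r α)) 0)
    (a : ℕ) (ha : a = res (p ^ r) (-α))
    (n : ℕ) (hn : (n : ℚ) = dashIter p r α * p - dashIter p (r - 1) α) :
    ratCongr p ((r : ℤ) + 3)
      (∑ l ∈ Finset.range a,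
        ((p : ℚ) ^ (3 * r) * ((p : ℚ) ^ r + 2 * α + 2 * (l : ℚ)) / (α + (l : ℚ)) ^ 3) *
          poch (α + (l : ℚ)) (p ^ r) ^ 3 * poch (1/2) (p ^ r) /
            (poch 1 (p ^ r) ^ 3 * poch (1/2 + α + (l : ℚ)) (p ^ r)))
      ((dashIter p r α) ^ 3 / dashIter p r (1/2 + α) * (p : ℚ) ^ (r + 2) * H2 n) := by
  
  haveI : Fact p.Prime := ⟨hp⟩
  obtain ⟨k, rfl⟩ : ∃ k, r = k + 1 := ⟨r - 1, by omega⟩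
  have hpd : ¬ p ∣ d := by
    intro h
    have h1 : p ∣ s := by
      have := (Nat.ModEq.of_dvd h hps)
      exact (Nat.modEq_zero_iff_dvd.1 (this.symm.trans (Nat.modEq_zero_iff_dvd.2 dvd_rfl)))
    have h2 := Nat.dvd_gcd (h1.mul_left c) h
    rw [hgcd] at h2
    exact hp.one_lt.ne' (Nat.dvd_one.1 h2)
  have hp2 : p ≠ 2 := by omega
  obtain ⟨h, hh⟩ : ∃ h, p = 2 * h + 1 := hp.odd_of_ne_two hp2
  have n2 : padicNorm p (1/2 : ℚ) = 1 := by
    have : padicNorm p ((2:ℕ):ℚ) = 1 := by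
      rw [padicNorm.nat_eq_one_iff, Nat.prime_dvd_prime_iff_eq hp Nat.prime_two]; exact hp2
    rw [padicNorm.div, padicNorm.one]; push_cast at this; rw [this]; norm_num
  have nα : padicNorm p α ≤ 1 := by
    rw [hα, padicNorm.div, (padicNorm.nat_eq_one_iff d).2 hpd, div_one]
    exact padicNorm.of_nat c
  have nβ : padicNorm p (1/2 + α) ≤ 1 := padicNorm.nonarchimedean.trans (max_le n2.le nα)
  obtain ⟨hA, e1, he1, EA⟩ := dash_spec α nα (k+1)
  obtain ⟨hA', e2, he2, EA'⟩ := dash_spec α nα k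
  obtain ⟨hB, e3, he3, EB⟩ := dash_spec (1/2 + α) nβ (k+1)
  obtain ⟨ra, rn⟩ := res_spec (k+1) α nα
  rw [← ha] at ra rn
  have hea : e1 = a := res_unique he1 ra (by rw [EA]; exact norm_mul_q hA) rn
  subst hea
  have hnorm := of_not_ratCongr hnd
  rw [Nat.add_sub_cancel] at hn
  set A := dashIter p (k+1) α with hAd
  set B := dashIter p (k+1) (1/2 + α) with hBd
  have hAh' : padicNorm p (1/2 + A) ≤ 1 := padicNorm.nonarchimedean.trans (max_le n2.le hA)
  rw [padicNorm.mul] at hnorm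
  have hB1 : padicNorm p B = 1 := by
    have := padicNorm.nonneg (p := p) B
    apply le_antisymm hB; nlinarith
  have hAh : padicNorm p (A + 1/2) = 1 := by
    rw [add_comm]
    have := padicNorm.nonneg (p := p) (1/2 + A)
    apply le_antisymm hAh'; nlinarith
  have hnn : n = e1 / p ^ k := by
    have : p ^ k * n + e2 = e1 := by
      have : ((p ^ k * n + e2 : ℕ) : ℚ) = e1 := by
        push_cast
        rw [hn]
        linear_combination EA' - EA
      exact_mod_cast this
    rw [← this, Nat.mul_add_div (pow_pos hp.pos _), Nat.div_eq_of_lt he2, add_zero]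
  have hodd : p ^ (k+1) % 2 = 1 := Nat.odd_iff.1 ((hp.odd_of_ne_two hp2).pow)
  obtain ⟨t, ht⟩ : ∃ t, p ^ (k+1) = 2 * t + 1 := ⟨p ^ (k+1) / 2, by omega⟩
  have htq : (p:ℚ)^(k+1) = 2 * t + 1 := by exact_mod_cast ht
  have nq : (p:ℚ)^(k+1) ≠ 0 := pow_ne_zero _ (by exact_mod_cast hp.ne_zero)
  have hc : (e1 ≤ t ∧ B = A + 1/2) ∨ (t < e1 ∧ B = A - 1/2) := by
    rcases le_or_gt e1 t with hle | hlt
    · left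
      refine ⟨hle, ?_⟩
      have e : 1/2 + α + ((e1 + t : ℕ) : ℚ) = (p:ℚ)^(k+1) * (A + 1/2) := by
        push_cast; linear_combination EA - (1/2) * htq
      have := res_unique (p := p) (k := k+1) (x := 1/2 + α) he3 (f := e1 + t) (by omega)
        (by rw [EB]; exact norm_mul_q hB) (by rw [e]; exact norm_mul_q hAh.le)
      rw [← this, EB] at e
      exact mul_left_cancel₀ nq e
    · right
      refine ⟨hlt, ?_⟩
      have e : 1/2 + α + ((e1 - (t + 1) : ℕ) : ℚ) = (p:ℚ)^(k+1) * (A - 1/2) := by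
        rw [Nat.cast_sub (by omega)]
        push_cast; linear_combination EA + (1/2) * htq
      have := res_unique (p := p) (k := k+1) (x := 1/2 + α) he3 (f := e1 - (t+1)) (by omega)
        (by rw [EB]; exact norm_mul_q hB) (by
          rw [e]; exact norm_mul_q (padicNorm.sub.trans (max_le hA n2.le)))
      rw [← this, EB] at e
      exact mul_left_cancel₀ nq e
  have hgoal : (((k + 1 : ℕ) : ℤ) + 3) = (((k + 3 : ℕ) : ℤ) + 1) := by push_cast; ring
  rw [hgoal]
  apply ratCongr_of
  rw [show k + 1 + 2 = k + 3 by ring, ← Finset.sum_range_reflect]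
  have main := assemble (p := p) k e1 n h A B
    (fun b => if 2 * b < p ^ (k+1) then A + 1/2 else B)
    (fun b => ((p : ℚ) ^ (3 * (k+1)) * ((p : ℚ) ^ (k+1) + 2 * (α + ((e1 - b : ℕ) : ℚ))) / (α + ((e1 - b : ℕ) : ℚ)) ^ 3) *
          poch (α + ((e1 - b : ℕ) : ℚ)) (p ^ (k+1)) ^ 3 * poch (1/2) (p ^ (k+1)) /
            (poch 1 (p ^ (k+1)) ^ 3 * poch (1/2 + (α + ((e1 - b : ℕ) : ℚ))) (p ^ (k+1))))
    hp5 hh hA hB1 he1 hnn hAh (fun _ _ _ => rfl) (by rcases hc with hc | hc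
                                                     · exact Or.inl hc.2
                                                     · right; omega) (by
      intro b h0 h1
      have hx : α + ((e1 - b : ℕ) : ℚ) = (p:ℚ)^(k+1) * A - b := by
        rw [Nat.cast_sub h1, ← EA]; ring
      by_cases hb : 2 * b < p ^ (k+1)
      · simp only [hb, if_true]
        refine term_main (k+1) A (A + 1/2) _ b (b + t) hp2 hA hAh h0 (by omega) (by omega) hx ?_
        rw [hx]; push_cast; linear_combination (-1/2) * htq
      · simp only [hb, if_false]
        have hBe : B = A - 1/2 := by
          rcases hc with hc | hc
          · omega
          · exact hc.2
        refine term_main (k+1) A B _ b (b - (t + 1)) hp2 hA hB1 h0 (by omega) (by omega) hx ?_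
        rw [hx, hBe, Nat.cast_sub (by omega)]; push_cast; linear_combination (1/2) * htq)
  rw [sum_Icc_one] at main
  convert main using 4 with j hj
  have : e1 - 1 - j = e1 - (j + 1) := by omega
  rw [this, mul_add 2 α, ← add_assoc ((p:ℚ)^(k+1)), ← add_assoc (1/2 : ℚ)]
end
end

section
/- Define, for a rational number x and a natural number k, F(x,k) = (2k+x) · (x)_k^3 (1/2)_k / ((1)_k^3 (1/2+x)_k) and G(x,k) = (k^3 (k+2x)/x^3) · (x)_k^3 (1/2)_k / ((1)_k^3 (1/2+x)_k). Let c, d, s be positive integers with d ≥ 2, 1 ≤ c, s ≤ d and gcd(cs, d) = 1, let p ≥ 5 be a prime with p ≡ s (mod d), set α = c/d, let r be a positive integer, and let a = ⟨−α⟩_{p^r}, so that α + a = α^{*_r} p^r. Then the telescoping identity ∑_{k=0}^{p^r−1} F(α, k) = ∑_{k=0}^{p^r−1} F(α^{*_r} p^r, k) − ∑_{l=0}^{a−1} G(α+l, p^r) holds as an identity of rational numbers. -/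
noncomputable section

/-- `F(x,k) = (2k+x) (x)_k^3 (1/2)_k / ((1)_k^3 (1/2+x)_k)`. -/
def Fwz (x : ℚ) (k : ℕ) : ℚ :=
  (2 * (k : ℚ) + x) * poch x k ^ 3 * poch (1/2) k /
    (poch 1 k ^ 3 * poch (1/2 + x) k)

/-- `G(x,k) = (k^3 (k+2x)/x^3) (x)_k^3 (1/2)_k / ((1)_k^3 (1/2+x)_k)`. -/
def Gwz (x : ℚ) (k : ℕ) : ℚ :=
  ((k : ℚ) ^ 3 * ((k : ℚ) + 2 * x) / x ^ 3) * poch x k ^ 3 * poch (1/2) k /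
    (poch 1 k ^ 3 * poch (1/2 + x) k)

lemma poch_succ' (x : ℚ) (n : ℕ) : poch x (n+1) = poch x n * (x + n) := by
  simp [poch, Finset.prod_range_succ]

lemma poch_pos' (x : ℚ) (hx : 0 < x) (n : ℕ) : 0 < poch x n :=
  Finset.prod_pos fun i _ => by positivity

lemma poch_shift' (x : ℚ) (n : ℕ) : x * poch (x+1) n = poch x n * (x + n) := by
  induction n with
  | zero => simp [poch]
  | succ k ih =>
    rw [poch_succ', poch_succ', ← mul_assoc, ih]; push_cast; ring

lemma wz_step (x : ℚ) (hx : 0 < x) (k : ℕ) :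
    Fwz (x+1) k - Fwz x k = Gwz x (k+1) - Gwz x k := by
  have h1 : poch (x+1) k = poch x k * (x + k) / x := by
    rw [← poch_shift']; field_simp
  have h2 : poch (1/2 + (x+1)) k = poch (1/2 + x) k * (1/2 + x + k) / (1/2 + x) := by
    rw [← poch_shift', ← add_assoc]; field_simp
  unfold Fwz Gwz
  rw [h1, h2, poch_succ', poch_succ', poch_succ', poch_succ']
  have ha := (poch_pos' 1 one_pos k).ne'
  have hb := (poch_pos' (1/2 + x) (by positivity) k).ne'
  have h3 : (1/2 + x + k : ℚ) ≠ 0 := by positivity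
  have h4 : (1/2 + x : ℚ) ≠ 0 := by positivity
  have h5 : (1 + (k:ℚ)) ≠ 0 := by positivity
  generalize poch x k = A at *
  generalize poch 1 k = B at *
  generalize poch (1/2 + x) k = C at *
  generalize poch (1/2) k = D at *
  push_cast
  have h6 : (1 + x * 2 + k * 2 : ℚ) ≠ 0 := by positivity
  have h7 : (1 + x * 2 : ℚ) ≠ 0 := by positivity
  have e3 : (1/2 + x + k : ℚ) = (1 + x * 2 + k * 2) / 2 := by ring
  have e4 : (1/2 + x : ℚ) = (1 + x * 2) / 2 := by ring
  rw [e3, e4]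
  field_simp
  ring

lemma wz_sum (x : ℚ) (hx : 0 < x) (n : ℕ) :
    ∑ k ∈ Finset.range n, Fwz (x+1) k - ∑ k ∈ Finset.range n, Fwz x k = Gwz x n := by
  rw [← Finset.sum_sub_distrib, Finset.sum_congr rfl fun k _ => wz_step x hx k,
    Finset.sum_range_sub]
  simp [Gwz]

lemma wz_tel (x : ℚ) (hx : 0 < x) (n a : ℕ) :
    ∑ k ∈ Finset.range n, Fwz x k = ∑ k ∈ Finset.range n, Fwz (x+a) k
      - ∑ l ∈ Finset.range a, Gwz (x + (l : ℚ)) n := by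
  induction a with
  | zero => simp
  | succ a ih =>
    rw [Finset.sum_range_succ, ← wz_sum (x + a) (by positivity) n, ih]
    push_cast
    rw [← add_assoc]; ring

lemma res_spec_s15 (m d : ℕ) (u : ℤ) (hm : 0 < m) (hd : 0 < d) (h : Nat.Coprime d m) :
    res m (-((u:ℚ)/d)) < m ∧ (m : ℤ) ∣ u + res m (-((u:ℚ)/d)) * d := by
  haveI : NeZero m := ⟨hm.ne'⟩
  set x : ℚ := -((u:ℚ)/d) with hx
  refine ⟨ZMod.val_lt _, ?_⟩
  have hd0 : (d:ℚ) ≠ 0 := by positivity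
  have hdq : (x.den : ℚ) ≠ 0 := by exact_mod_cast x.den_ne_zero
  have key : x.num * d = -u * x.den := by
    have h1 : (x.num : ℚ) = x * x.den := (Rat.mul_den_eq_num x).symm
    have : (x.num : ℚ) * d = -u * x.den := by
      rw [h1, hx]; field_simp
    exact_mod_cast this
  have hdvd : x.den ∣ d := by
    have h2 : (x.den : ℤ) ∣ x.num * d := by rw [key]; exact dvd_mul_left _ _
    have h3 : IsCoprime (x.den : ℤ) x.num := by
      rw [Int.isCoprime_iff_gcd_eq_one, Int.gcd_comm]; exact x.reduced
    exact_mod_cast h3.dvd_of_dvd_mul_left h2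
  have hc : Nat.Coprime x.den m := Nat.Coprime.coprime_dvd_left hdvd h
  rw [← ZMod.intCast_zmod_eq_zero_iff_dvd]
  have hu := ZMod.coe_mul_inv_eq_one x.den hc
  have key' := congrArg (Int.cast : ℤ → ZMod m) key
  push_cast at key' ⊢
  have e : ((res m x : ℕ) : ZMod m) = (x.num : ZMod m) * (x.den : ZMod m)⁻¹ := by
    simp [res]
  rw [e]
  linear_combination (x.den : ZMod m)⁻¹ * key' - u * hu

lemma dashIter_spec (p d : ℕ) (u : ℤ) (hp : 0 < p) (hd : 0 < d) (h : Nat.Coprime d p) (r : ℕ) :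
    ∃ (v : ℤ) (b : ℕ), dashIter p r ((u:ℚ)/d) = v / d ∧ b < p ^ r ∧ v * p ^ r = u + b * d := by
  induction r with
  | zero => exact ⟨u, 0, by simp [dashIter]⟩
  | succ r ih =>
    obtain ⟨v, b, h1, h2, h3⟩ := ih
    obtain ⟨h4, w, h5⟩ := res_spec_s15 p d v hp hd h
    refine ⟨w, b + res p (-((v:ℚ)/d)) * p ^ r, ?_, ?_, ?_⟩
    · have : dashIter p (r+1) ((u:ℚ)/d) = dash p (dashIter p r ((u:ℚ)/d)) := by
        simp only [dashIter, Function.iterate_succ_apply']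
      rw [this, h1, dash]
      have h5' : (v : ℚ) + (res p (-((v:ℚ)/d)) : ℚ) * d = p * w := by exact_mod_cast h5
      have hd0 : (d:ℚ) ≠ 0 := by positivity
      have hp0 : (p:ℚ) ≠ 0 := by positivity
      generalize (res p (-((v:ℚ)/d)) : ℚ) = t at *
      field_simp
      linear_combination h5'
    · rw [pow_succ]
      generalize res p (-((v:ℚ)/d)) = t at *
      nlinarith [Nat.mul_le_mul_right (p^r) (Nat.succ_le_of_lt h4)]
    · push_cast
      linear_combination h3 - (p:ℤ)^r * h5

theorem stmt15 (c d s : ℕ) (hc1 : 1 ≤ c) (hcd : c ≤ d) (hs1 : 1 ≤ s) (hsd : s ≤ d)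
    (hd : 2 ≤ d) (hgcd : Nat.gcd (c * s) d = 1)
    (p : ℕ) (hp : p.Prime) (hp5 : 5 ≤ p) (hps : p ≡ s [MOD d])
    (α : ℚ) (hα : α = (c : ℚ) / d)
    (r : ℕ) (hr : 1 ≤ r)
    (a : ℕ) (ha : a = res (p ^ r) (-α)) :
    α + (a : ℚ) = dashIter p r α * (p : ℚ) ^ r ∧
    ∑ k ∈ Finset.range (p ^ r), Fwz α k =
      ∑ k ∈ Finset.range (p ^ r), Fwz (dashIter p r α * (p : ℚ) ^ r) k -
        ∑ l ∈ Finset.range a, Gwz (α + (l : ℚ)) (p ^ r) := by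
  have hd0 : 0 < d := by omega
  have hcop : Nat.Coprime d p := by
    have h1 : Nat.Coprime s d := Nat.Coprime.coprime_mul_left hgcd
    have h2 : Nat.gcd p d = Nat.gcd s d := hps.gcd_eq
    exact Nat.Coprime.symm (h2.trans h1)
  have hmain : α + (a : ℚ) = dashIter p r α * (p : ℚ) ^ r := by
    obtain ⟨v, b, h1, h2, h3⟩ := dashIter_spec p d c hp.pos hd0 hcop r
    obtain ⟨h4, h5⟩ := res_spec_s15 (p^r) d c (pow_pos hp.pos r) hd0 (hcop.pow_right r)
    rw [Int.cast_natCast, ← hα] at h1 h4 h5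
    rw [← ha] at h4 h5
    have h6 : ((p^r : ℕ) : ℤ) ∣ ((a:ℤ) - b) * d := by
      have h7 : ((p^r : ℕ) : ℤ) ∣ c + b * d := ⟨v, by push_cast; linear_combination -h3⟩
      have := dvd_sub h5 h7
      have e : ((c:ℤ) + a * d) - (c + b * d) = ((a:ℤ) - b) * d := by ring
      rwa [e] at this
    have h8 : IsCoprime ((p^r : ℕ) : ℤ) (d : ℤ) :=
      Nat.isCoprime_iff_coprime.mpr (hcop.pow_right r).symm
    have h9 := h8.dvd_of_dvd_mul_right h6
    have hab : b ≡ a [MOD p^r] := (Nat.modEq_iff_dvd).mpr h9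
    have hab' : b = a := Nat.ModEq.eq_of_lt_of_lt hab h2 h4
    subst hab'
    rw [h1, hα]
    have h3' : (v:ℚ) * p^r = c + b * d := by exact_mod_cast h3
    have : (d:ℚ) ≠ 0 := by positivity
    field_simp
    linear_combination -h3'
  refine ⟨hmain, ?_⟩
  rw [← hmain]
  exact wz_tel α (by rw [hα]; positivity) _ a
end
end
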